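/- Let Θ ⊆ ℝ^q (not necessarily compact), let k0 ≥ 1 and G0 = Σ_{i=1}^{k0} p_i^0 δ_{θ_i^0} ∈ E_{k0}(Θ). Suppose Φ is a (G0,k0) first-order linear independent domain. Then the exact-fitted inverse bound with one argument fixed holds: there exist r > 0 and c > 0 such that sup_{φ∈Φ}|Gφ − G0φ| ≥ c · W_1(G,G0) for every G ∈ G_{k0}(Θ) with W_1(G,G0) ≤ r. -/

import Mathlib

open scoped BigOperators ENNReal

noncomputable section

abbrev Euc (q : ℕ) : Type := EuclideanSpace ℝ (Fin q)

def IsMixingMeasure {q : ℕ} (Θ : Set (Euc q)) (G : Euc q →₀ ℝ) : Prop :=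
  (∀ x ∈ G.support, 0 < G x) ∧ (∑ x ∈ G.support, G x) = 1 ∧ ↑G.support ⊆ Θ

/-- `E_k(Θ)`: discrete probability measures on `Θ` with exactly `k` atoms. -/
def MixE {q : ℕ} (Θ : Set (Euc q)) (k : ℕ) (G : Euc q →₀ ℝ) : Prop :=
  IsMixingMeasure Θ G ∧ G.support.card = k

/-- `G_k(Θ)`: discrete probability measures on `Θ` with at most `k` atoms. -/
def MixG {q : ℕ} (Θ : Set (Euc q)) (k : ℕ) (G : Euc q →₀ ℝ) : Prop :=
  IsMixingMeasure Θ G ∧ G.support.card ≤ k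

/-- `Gφ = ∑ᵢ pᵢ φ(θᵢ)`. -/
def mixInt {q : ℕ} (G : Euc q →₀ ℝ) (φ : Euc q → ℝ) : ℝ :=
  ∑ x ∈ G.support, G x * φ x

def IsCoupling {q : ℕ} (G H : Euc q →₀ ℝ) (π : Euc q × Euc q → ℝ) : Prop :=
  (∀ p, 0 ≤ π p) ∧
  (∀ x ∈ G.support, (∑ y ∈ H.support, π (x, y)) = G x) ∧
  (∀ y ∈ H.support, (∑ x ∈ G.support, π (x, y)) = H y)

/-- `Wpow ℓ G H = W_ℓ(G,H)^ℓ`, the minimal transport cost with cost `‖θ-θ'‖^ℓ`. -/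
def Wpow {q : ℕ} (ℓ : ℝ) (G H : Euc q →₀ ℝ) : ℝ :=
  sInf { c | ∃ π : Euc q × Euc q → ℝ, IsCoupling G H π ∧
    c = ∑ p ∈ G.support ×ˢ H.support, π p * ‖p.1 - p.2‖ ^ ℓ }

/-- `sup_{φ ∈ Φ} |Gφ - Hφ|`, valued in `ℝ≥0∞`. -/
def phiDist {q : ℕ} (Φ : Set (Euc q → ℝ)) (G H : Euc q →₀ ℝ) : ℝ≥0∞ :=
  ⨆ φ ∈ Φ, ENNReal.ofReal |mixInt G φ - mixInt H φ|

/-- Multi-indices `α ∈ ℕ^q` with `|α| ≤ n`, as a finite set. -/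
def multiIdx (q n : ℕ) : Finset (Fin q → ℕ) :=
  (Fintype.piFinset fun _ : Fin q => Finset.range (n + 1)).filter fun α => (∑ j, α j) ≤ n

def pderivSeq {q : ℕ} : List (Fin q) → (Euc q → ℝ) → (Euc q → ℝ)
  | [], f => f
  | i :: l, f => pderivSeq l fun x => fderiv ℝ f x (EuclideanSpace.single i 1)

/-- The partial derivative `D^α` of multi-order `α`. -/
def Dmulti {q : ℕ} (α : Fin q → ℕ) (f : Euc q → ℝ) : Euc q → ℝ :=
  pderivSeq ((List.finRange q).flatMap fun i => List.replicate (α i) i) f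


open Filter Topology

/-- Finitely many functionals out of a family with trivial common kernel on a finite-dimensional
space already control the norm. -/
lemma exists_finset_norm_le_sum_abs {V ι : Type*} [NormedAddCommGroup V] [NormedSpace ℝ V]
    [FiniteDimensional ℝ V] (L : ι → V →L[ℝ] ℝ) (hL : ∀ v, (∀ i, L i v = 0) → v = 0) :
    ∃ F : Finset ι, ∃ c > (0 : ℝ), ∀ v, c * ‖v‖ ≤ ∑ i ∈ F, |L i v| := by
  have hc : IsCompact (Metric.sphere (0 : V) 1) := isCompact_sphere 0 1
  obtain ⟨F, hF⟩ := hc.elim_finite_subcover (fun i => {v | L i v ≠ 0})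
    (fun i => isOpen_ne_fun (L i).continuous continuous_const) (by
      intro v hv
      by_contra hcon
      have h0 : v = 0 := hL v (by simpa using hcon)
      simp [h0] at hv)
  obtain ⟨c, hc0, hcF⟩ : ∃ c > (0 : ℝ), ∀ v ∈ Metric.sphere (0 : V) 1,
      c ≤ ∑ i ∈ F, |L i v| := by
    rcases (Metric.sphere (0 : V) 1).eq_empty_or_nonempty with he | hne
    · exact ⟨1, one_pos, by simp [he]⟩
    · obtain ⟨v, hv, hmin⟩ := hc.exists_isMinOn hne
        (f := fun v => ∑ i ∈ F, |L i v|) (by fun_prop)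
      refine ⟨∑ i ∈ F, |L i v|, ?_, fun w hw => hmin hw⟩
      obtain ⟨i, hi, hiv⟩ : ∃ i ∈ F, L i v ≠ 0 := by simpa using hF hv
      exact Finset.sum_pos' (fun _ _ => abs_nonneg _) ⟨i, hi, abs_pos.2 hiv⟩
  refine ⟨F, c, hc0, fun v => ?_⟩
  rcases eq_or_ne v 0 with rfl | hv
  · simp
  · have hn : 0 < ‖v‖ := norm_pos_iff.2 hv
    have h := hcF (‖v‖⁻¹ • v) (by simp [norm_smul, hn.ne'])
    simp only [map_smul, smul_eq_mul, abs_mul, abs_inv, abs_norm, ← Finset.mul_sum] at h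
    rwa [inv_mul_eq_div, le_div_iff₀ hn] at h

lemma nonneg_of_isMixingMeasure {q : ℕ} {Θ : Set (Euc q)} {G : Euc q →₀ ℝ}
    (hG : IsMixingMeasure Θ G) (x : Euc q) : 0 ≤ G x := by
  by_cases hx : x ∈ G.support
  · exact (hG.1 x hx).le
  · rw [Finsupp.notMem_support_iff.1 hx]

lemma IsCoupling.cost_nonneg {q : ℕ} {G H : Euc q →₀ ℝ} {π : Euc q × Euc q → ℝ} {ℓ : ℝ}
    (hπ : IsCoupling G H π) :
    0 ≤ ∑ p ∈ G.support ×ˢ H.support, π p * ‖p.1 - p.2‖ ^ ℓ :=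
  Finset.sum_nonneg fun p _ => mul_nonneg (hπ.1 p) (by positivity)

lemma Wpow_le_of_isCoupling {q : ℕ} {G H : Euc q →₀ ℝ} {π : Euc q × Euc q → ℝ} {ℓ : ℝ}
    (hπ : IsCoupling G H π) :
    Wpow ℓ G H ≤ ∑ p ∈ G.support ×ˢ H.support, π p * ‖p.1 - p.2‖ ^ ℓ := by
  refine csInf_le ⟨0, ?_⟩ ⟨π, hπ, rfl⟩
  rintro _ ⟨π', hπ', rfl⟩
  exact hπ'.cost_nonneg

lemma isCoupling_prod {q : ℕ} {Θ : Set (Euc q)} {G H : Euc q →₀ ℝ}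
    (hG : IsMixingMeasure Θ G) (hH : IsMixingMeasure Θ H) :
    IsCoupling G H (fun p => G p.1 * H p.2) := by
  refine ⟨fun p => mul_nonneg (nonneg_of_isMixingMeasure hG _) (nonneg_of_isMixingMeasure hH _),
    fun x _ => ?_, fun y _ => ?_⟩
  · simp only [← Finset.mul_sum, hH.2.1, mul_one]
  · simp only [← Finset.sum_mul, hG.2.1, one_mul]

/-- An atom of `H` at distance at least `δ` from all atoms of `G` costs at least `δ` times its
mass. -/
lemma mul_le_Wpow_one {q : ℕ} {Θ : Set (Euc q)} {G H : Euc q →₀ ℝ}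
    (hG : IsMixingMeasure Θ G) (hH : IsMixingMeasure Θ H) {x : Euc q} (hx : x ∈ H.support)
    {δ : ℝ} (hδ : ∀ y ∈ G.support, δ ≤ ‖y - x‖) : H x * δ ≤ Wpow 1 G H := by
  refine le_csInf ⟨_, _, isCoupling_prod hG hH, rfl⟩ ?_
  rintro _ ⟨π, hπ, rfl⟩
  rw [← hπ.2.2 x hx, Finset.sum_mul, Finset.sum_product]
  refine Finset.sum_le_sum fun y hy => ?_
  refine le_trans ?_ (Finset.single_le_sum
    (f := fun z => π (y, z) * ‖y - z‖ ^ (1 : ℝ))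
    (fun z _ => mul_nonneg (hπ.1 _) (by positivity)) hx)
  simpa using mul_le_mul_of_nonneg_left (hδ y hy) (hπ.1 (y, x))

/-- If the atoms of `G` are matched with those of `H` by `T`, keeping the common mass on matched
pairs bounds the transport cost. -/
lemma Wpow_one_le_of_matching {q : ℕ} {Θ : Set (Euc q)} {G H : Euc q →₀ ℝ}
    (hG : IsMixingMeasure Θ G) (hH : IsMixingMeasure Θ H) {T : Euc q → Euc q}
    (hT : Set.InjOn T H.support) (hTG : G.support = H.support.image T) {D : ℝ}
    (hD : ∀ x ∈ H.support, ∀ y ∈ H.support, ‖T x - y‖ ≤ D) :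
    Wpow 1 G H ≤ ∑ x ∈ H.support, G (T x) * ‖T x - x‖ +
      D * ∑ x ∈ H.support, |G (T x) - H x| := by
  set S := H.support with hS
  have hGn := nonneg_of_isMixingMeasure hG
  have hHn := nonneg_of_isMixingMeasure hH
  have hsum : ∀ f : Euc q → ℝ, ∑ y ∈ G.support, f y = ∑ x ∈ S, f (T x) := fun f => by
    rw [hTG, Finset.sum_image hT]
  set m : Euc q → ℝ := fun x => min (G (T x)) (H x) with hm
  set m' : Euc q → ℝ := fun y => ∑ x ∈ S, if y = T x then m x else 0 with hm'
  have hmn : ∀ x, 0 ≤ m x := fun x => le_min (hGn _) (hHn _)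
  have hmH : ∀ x, m x ≤ H x := fun x => min_le_right _ _
  have hmG : ∀ x, m x ≤ G (T x) := fun x => min_le_left _ _
  have hiff : ∀ x ∈ S, ∀ y ∈ S, (T x = T y ↔ x = y) := fun x hx y hy => hT.eq_iff hx hy
  have hm'T : ∀ x ∈ S, m' (T x) = m x := fun x hx => by
    rw [hm']
    simp only
    rw [Finset.sum_eq_single_of_mem x hx]
    · simp
    · intro b hb hbx
      rw [if_neg]
      rw [hiff x hx b hb]
      exact hbx.symm
  have hm'G : ∀ y, m' y ≤ G y := fun y => by
    by_cases hy : ∃ x ∈ S, y = T x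
    · obtain ⟨x, hx, rfl⟩ := hy
      rw [hm'T x hx]; exact hmG x
    · push Not at hy
      rw [hm']
      simp only
      rw [Finset.sum_eq_zero fun x hx => if_neg (hy x hx)]
      exact hGn y
  set R := ∑ x ∈ S, (H x - m x) with hR
  have hRG : ∑ x ∈ S, (G (T x) - m x) = R := by
    rw [hR, Finset.sum_sub_distrib, Finset.sum_sub_distrib, ← hsum, hG.2.1, hS, hH.2.1]
  have hRn : 0 ≤ R := Finset.sum_nonneg fun x _ => sub_nonneg.2 (hmH x)
  set π : Euc q × Euc q → ℝ := fun p =>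
    (if p.1 = T p.2 then m p.2 else 0) + (G p.1 - m' p.1) * (H p.2 - m p.2) / R with hπdef
  have hdiv : ∀ f : Euc q → ℝ, (∀ x ∈ S, 0 ≤ f x) → ∑ x ∈ S, f x = R →
      ∀ x ∈ S, f x * R / R = f x := by
    intro f hf hfR x hx
    rcases eq_or_ne R 0 with h0 | h0
    · rw [h0] at hfR
      rw [(Finset.sum_eq_zero_iff_of_nonneg hf).1 hfR x hx]
      simp
    · field_simp
  have hπT : ∀ x ∈ S, ∀ z ∈ S, π (T x, z) =
      (if z = x then m x else 0) + (G (T x) - m x) * (H z - m z) / R := by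
    intro x hx z hz
    simp only [hπdef, hm'T x hx, hiff x hx z hz]
    by_cases h : z = x
    · simp [h]
    · simp [h, Ne.symm h]
  have hπ : IsCoupling G H π := by
    refine ⟨fun p => ?_, fun y hy => ?_, fun z hz => ?_⟩
    · refine add_nonneg ?_ (div_nonneg (mul_nonneg (sub_nonneg.2 (hm'G _))
        (sub_nonneg.2 (hmH _))) hRn)
      split_ifs
      exacts [hmn _, le_rfl]
    · rw [hTG] at hy
      obtain ⟨x, hx, rfl⟩ := Finset.mem_image.1 hy
      rw [Finset.sum_congr rfl (hπT x hx), Finset.sum_add_distrib, Finset.sum_ite_eq' S x,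
        if_pos hx, ← Finset.sum_div, ← Finset.mul_sum, ← hR,
        hdiv (fun x => G (T x) - m x) (fun x _ => sub_nonneg.2 (hmG x)) hRG x hx]
      ring
    · rw [hsum, Finset.sum_congr rfl fun x hx => hπT x hx z hz, Finset.sum_add_distrib,
        Finset.sum_ite_eq S z, if_pos hz, ← Finset.sum_div, ← Finset.sum_mul, hRG, mul_comm R,
        hdiv (fun x => H x - m x) (fun x _ => sub_nonneg.2 (hmH x)) hR.symm z hz]
      ring
  refine (Wpow_le_of_isCoupling hπ).trans ?_
  rw [Finset.sum_product, hsum]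
  have hrow : ∀ x ∈ S, ∑ z ∈ S, π (T x, z) * ‖T x - z‖ ^ (1 : ℝ) ≤
      m x * ‖T x - x‖ + D * (G (T x) - m x) := by
    intro x hx
    have hle : ∀ z ∈ S, π (T x, z) * ‖T x - z‖ ^ (1 : ℝ) ≤
        (if z = x then m x * ‖T x - x‖ else 0) +
          (G (T x) - m x) * (H z - m z) / R * D := by
      intro z hz
      rw [hπT x hx z hz, Real.rpow_one, add_mul]
      refine add_le_add ?_ (mul_le_mul_of_nonneg_left (hD x hx z hz) (div_nonneg (mul_nonneg
        (sub_nonneg.2 (hmG _)) (sub_nonneg.2 (hmH _))) hRn))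
      split_ifs with h
      · rw [h]
      · simp
    refine (Finset.sum_le_sum hle).trans (le_of_eq ?_)
    rw [Finset.sum_add_distrib, Finset.sum_ite_eq' S x, if_pos hx, ← Finset.sum_mul,
      ← Finset.sum_div, ← Finset.mul_sum, ← hR,
      hdiv (fun x => G (T x) - m x) (fun x _ => sub_nonneg.2 (hmG x)) hRG x hx]
    ring
  refine (Finset.sum_le_sum hrow).trans ?_
  rw [Finset.sum_add_distrib, Finset.mul_sum]
  refine add_le_add (Finset.sum_le_sum fun x _ =>
    mul_le_mul_of_nonneg_right (hmG x) (norm_nonneg _)) (Finset.sum_le_sum fun x hx => ?_)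
  refine mul_le_mul_of_nonneg_left ?_ ((norm_nonneg _).trans (hD x hx x hx))
  rcases min_cases (G (T x)) (H x) with h | h
  · simp [hm, h.1]
  · simpa [hm, h.1] using le_abs_self (G (T x) - H x)

/-- A mixing measure with at most as many atoms as `H` that is close to `H` has exactly one atom
near each atom of `H`. -/
lemma exists_matching {q : ℕ} {Θ : Set (Euc q)} {H : Euc q →₀ ℝ} (hH : IsMixingMeasure Θ H)
    {δ : ℝ} (hδ : 0 < δ) (hsep : ∀ x ∈ H.support, ∀ y ∈ H.support, x ≠ y → 2 * δ ≤ ‖x - y‖) :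
    ∃ r > (0 : ℝ), ∀ G, MixG Θ H.support.card G → Wpow 1 G H ≤ r →
      ∃ T : Euc q → Euc q, Set.InjOn T H.support ∧ G.support = H.support.image T ∧
        ∀ x ∈ H.support, ‖T x - x‖ < δ := by
  obtain ⟨r, hr, hrH⟩ : ∃ r > (0 : ℝ), ∀ x ∈ H.support, r < H x * δ := by
    have h : ∀ᶠ r in 𝓝[>] (0 : ℝ), ∀ x ∈ H.support, r < H x * δ := by
      refine (Filter.eventually_all_finset _).2 fun x hx => ?_
      exact nhdsWithin_le_nhds (eventually_lt_nhds (mul_pos (hH.1 x hx) hδ))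
    obtain ⟨r, h1, h2⟩ := (h.and self_mem_nhdsWithin).exists
    exact ⟨r, h2, h1⟩
  refine ⟨r, hr, fun G hG hW => ?_⟩
  have hex : ∀ x, ∃ y, x ∈ H.support → y ∈ G.support ∧ ‖y - x‖ < δ := by
    intro x
    by_contra! hcon
    have hx := (hcon 0).1
    exact absurd (mul_le_Wpow_one hG.1 hH hx fun y hy => (hcon y).2 hy)
      (not_le.2 (hW.trans_lt (hrH x hx)))
  choose T hT using hex
  have hinj : Set.InjOn T H.support := by
    intro x hx y hy hxy
    by_contra hne
    have h1 := (hT x hx).2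
    have h2 := (hT y hy).2
    rw [← hxy] at h2
    have h3 := norm_sub_le (T x - y) (T x - x)
    rw [sub_sub_sub_cancel_left] at h3
    linarith [hsep x hx y hy hne]
  refine ⟨T, hinj, ?_, fun x hx => (hT x hx).2⟩
  refine (Finset.eq_of_subset_of_card_le (fun y hy => ?_) ?_).symm
  · obtain ⟨x, hx, rfl⟩ := Finset.mem_image.1 hy
    exact (hT x hx).1
  · rw [Finset.card_image_of_injOn hinj]
    exact hG.2

lemma flatMap_replicate_single {q : ℕ} (j : Fin q) (l : List (Fin q)) (hl : l.Nodup) :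
    (l.flatMap fun i => List.replicate ((Pi.single j 1 : Fin q → ℕ) i) i) =
      if j ∈ l then [j] else [] := by
  induction l with
  | nil => simp
  | cons a l ih =>
    rw [List.nodup_cons] at hl
    rw [List.flatMap_cons, ih hl.2]
    by_cases h : a = j
    · subst h
      simp [hl.1]
    · simp [Ne.symm h]

lemma Dmulti_zero {q : ℕ} (f : Euc q → ℝ) : Dmulti 0 f = f := by
  have h : ((List.finRange q).flatMap fun i => List.replicate ((0 : Fin q → ℕ) i) i) = [] := by
    simp [List.flatMap_eq_nil_iff]
  rw [Dmulti, h, pderivSeq]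

lemma Dmulti_single {q : ℕ} (j : Fin q) (f : Euc q → ℝ) (x : Euc q) :
    Dmulti (Pi.single j 1) f x = fderiv ℝ f x (EuclideanSpace.single j 1) := by
  rw [Dmulti, flatMap_replicate_single j _ (List.nodup_finRange q)]
  simp [pderivSeq]

lemma mem_multiIdx_one {q : ℕ} (α : Fin q → ℕ) :
    α ∈ multiIdx q 1 ↔ α = 0 ∨ ∃ j, α = Pi.single j 1 := by
  simp only [multiIdx, Finset.mem_filter, Fintype.mem_piFinset, Finset.mem_range]
  constructor
  · rintro ⟨-, h⟩
    by_cases h0 : α = 0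
    · exact Or.inl h0
    · right
      obtain ⟨j, hj⟩ := Function.ne_iff.1 h0
      refine ⟨j, funext fun i => ?_⟩
      have hsplit := Finset.add_sum_erase Finset.univ α (Finset.mem_univ j)
      simp only [Pi.zero_apply] at hj
      by_cases hi : i = j
      · subst hi
        simp only [Pi.single_eq_same]
        omega
      · rw [Pi.single_eq_of_ne hi]
        have := Finset.single_le_sum (f := α) (fun _ _ => Nat.zero_le _)
          (Finset.mem_erase.2 ⟨hi, Finset.mem_univ i⟩)
        omega
  · rintro (rfl | ⟨j, rfl⟩)
    · simp
    · refine ⟨fun i => ?_, by simp⟩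
      by_cases hi : i = j
      · subst hi; simp
      · simp [Pi.single_eq_of_ne hi]

lemma sum_multiIdx_one {q : ℕ} (g : (Fin q → ℕ) → ℝ) :
    ∑ α ∈ multiIdx q 1, g α = g 0 + ∑ j, g (Pi.single j 1) := by
  classical
  have hinj : Function.Injective (fun j : Fin q => (Pi.single j 1 : Fin q → ℕ)) := by
    intro i j h
    by_contra hne
    have := congrFun h i
    simp [Pi.single_eq_of_ne hne] at this
  have h : multiIdx q 1 =
      insert 0 (Finset.univ.image fun j : Fin q => (Pi.single j 1 : Fin q → ℕ)) := by
    ext α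
    simp [mem_multiIdx_one, eq_comm]
  rw [h, Finset.sum_insert, Finset.sum_image hinj.injOn]
  simp

/-- The first-order functional `(a, b) ↦ ∑ₓ aₓ φ(x) + Dφ(x) bₓ` over the points of `S`. -/
def firstOrder {q : ℕ} (S : Finset (Euc q)) (φ : Euc q → ℝ) :
    ((S → ℝ) × (S → Euc q)) →L[ℝ] ℝ :=
  ∑ x : S, (φ x • (ContinuousLinearMap.proj x).comp (ContinuousLinearMap.fst ℝ _ _) +
    ((fderiv ℝ φ x).comp (ContinuousLinearMap.proj x)).comp (ContinuousLinearMap.snd ℝ _ _))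

lemma firstOrder_apply {q : ℕ} (S : Finset (Euc q)) (φ : Euc q → ℝ)
    (v : (S → ℝ) × (S → Euc q)) :
    firstOrder S φ v = ∑ x : S, (v.1 x * φ x + fderiv ℝ φ x (v.2 x)) := by
  simp [firstOrder, mul_comm]

/-- The total mass `(a, b) ↦ ∑ₓ aₓ`. -/
def totalMass {q : ℕ} (S : Finset (Euc q)) : ((S → ℝ) × (S → Euc q)) →L[ℝ] ℝ :=
  ∑ x : S, (ContinuousLinearMap.proj x).comp (ContinuousLinearMap.fst ℝ _ _)

lemma totalMass_apply {q : ℕ} (S : Finset (Euc q)) (v : (S → ℝ) × (S → Euc q)) :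
    totalMass S v = ∑ x : S, v.1 x := by
  simp [totalMass]

lemma apply_eq_sum_single {q : ℕ} (A : Euc q →L[ℝ] ℝ) (b : Euc q) :
    A b = ∑ j, b j * A (EuclideanSpace.single j 1) := by
  conv_lhs => rw [← (EuclideanSpace.basisFun (Fin q) ℝ).sum_repr b]
  simp

lemma eq_zero_of_firstOrder_eq_zero {q : ℕ} {Φ : Set (Euc q → ℝ)} {S : Finset (Euc q)}
    (hind : ∀ a : Euc q → (Fin q → ℕ) → ℝ,
      (∀ φ ∈ Φ, ∑ x ∈ S, ∑ α ∈ multiIdx q 1, a x α * Dmulti α φ x = 0) →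
      (∑ x ∈ S, a x 0 = 0) → ∀ x ∈ S, ∀ α ∈ multiIdx q 1, a x α = 0)
    (v : (S → ℝ) × (S → Euc q)) (hv : ∀ φ ∈ Φ, firstOrder S φ v = 0)
    (hv0 : totalMass S v = 0) : v = 0 := by
  classical
  set a : Euc q → (Fin q → ℕ) → ℝ := fun x α => if hx : x ∈ S then
    (if α = 0 then v.1 ⟨x, hx⟩ else ∑ j, α j * v.2 ⟨x, hx⟩ j) else 0 with ha
  have ha0 : ∀ x : S, a x 0 = v.1 x := fun x => by simp [ha]
  have ha1 : ∀ (x : S) (j : Fin q), a x (Pi.single j 1) = v.2 x j := fun x j => by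
    simp [ha, Pi.single_apply]
  have key := hind a (fun φ hφ => ?_) ?_
  · refine Prod.ext (funext fun x => ?_) (funext fun x => ?_)
    · rw [← ha0 x]
      exact key x x.2 0 ((mem_multiIdx_one _).2 (Or.inl rfl))
    · ext j
      rw [← ha1 x j]
      exact key x x.2 _ ((mem_multiIdx_one _).2 (Or.inr ⟨j, rfl⟩))
  · rw [← hv φ hφ, firstOrder_apply, ← Finset.sum_coe_sort S]
    refine Finset.sum_congr rfl fun x _ => ?_
    rw [sum_multiIdx_one, ha0, Dmulti_zero, apply_eq_sum_single]
    simp only [ha1, Dmulti_single]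
  · rw [← Finset.sum_coe_sort S, ← hv0, totalMass_apply]
    exact Finset.sum_congr rfl fun x _ => ha0 x

lemma eventually_abs_taylor_le {q : ℕ} {φ : Euc q → ℝ} {x : Euc q} (h : DifferentiableAt ℝ φ x)
    {ε : ℝ} (hε : 0 < ε) :
    ∀ᶠ z in 𝓝 (0 : Euc q), |φ (x + z) - φ x - fderiv ℝ φ x z| ≤ ε * ‖z‖ := by
  simpa using (hasFDerivAt_iff_isLittleO_nhds_zero.1 h.hasFDerivAt).def hε

/-- if `Φ` is a `(G0,k0)` first-order linear independent domain, then the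
exact-fitted inverse bound `sup_φ |Gφ - G0φ| ≥ c W_1(G,G0)` holds near `G0`
(no compactness needed). -/
theorem exact_fitted_inverse_bound {q k0 : ℕ} (hk0 : 1 ≤ k0)
    (Θ : Set (Euc q))
    (Φ : Set (Euc q → ℝ))
    (G0 : Euc q →₀ ℝ) (hG0 : MixE Θ k0 G0)
    (hsmooth : ∀ φ ∈ Φ, ∀ x ∈ G0.support, ContDiffAt ℝ 1 φ x)
    (hind : ∀ a : Euc q → (Fin q → ℕ) → ℝ,
      (∀ φ ∈ Φ, ∑ x ∈ G0.support, ∑ α ∈ multiIdx q 1, a x α * Dmulti α φ x = 0) →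
      (∑ x ∈ G0.support, a x 0 = 0) →
      ∀ x ∈ G0.support, ∀ α ∈ multiIdx q 1, a x α = 0) :
    ∃ r > (0:ℝ), ∃ c > (0:ℝ), ∀ G : Euc q →₀ ℝ, MixG Θ k0 G → Wpow 1 G G0 ≤ r →
      ENNReal.ofReal (c * Wpow 1 G G0) ≤ phiDist Φ G G0 := by
  obtain ⟨hG0m, rfl⟩ := hG0
  set S := G0.support with hS
  obtain ⟨F, c, hc, hF⟩ := exists_finset_norm_le_sum_abs
    (fun i : Option Φ => i.elim (totalMass S) fun φ => firstOrder S φ)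
    (fun v hv => eq_zero_of_firstOrder_eq_zero hind v (fun φ hφ => hv (some ⟨φ, hφ⟩)) (hv none))
  set N : ℝ := (F.card : ℝ) with hN
  set s : ℝ := (S.card : ℝ) with hs
  have hN0 : 0 ≤ N := Nat.cast_nonneg _
  have hs1 : 1 ≤ s := Nat.one_le_cast.2 hk0
  set ε : ℝ := c / (2 * (N + 1) * s) with hεdef
  have hε : 0 < ε := by positivity
  obtain ⟨δ, hδ, hloc⟩ : ∃ δ > 0, ∀ z : Euc q, ‖z‖ < δ → ∀ x ∈ S, ∀ i ∈ F, ∀ φ : Φ,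
      i = some φ → |φ.1 (x + z) - φ.1 x - fderiv ℝ φ.1 x z| ≤ ε * ‖z‖ := by
    have h : ∀ᶠ z in 𝓝 (0 : Euc q), ∀ x ∈ S, ∀ i ∈ F, ∀ φ : Φ,
        i = some φ → |φ.1 (x + z) - φ.1 x - fderiv ℝ φ.1 x z| ≤ ε * ‖z‖ := by
      refine (Filter.eventually_all_finset _).2 fun x hx =>
        (Filter.eventually_all_finset _).2 fun i _ => ?_
      cases i with
      | none => simp
      | some φ =>
        filter_upwards [eventually_abs_taylor_le
          ((hsmooth φ.1 φ.2 x hx).differentiableAt one_ne_zero) hε] with z hz ψ hψ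
        obtain rfl := Option.some.inj hψ
        exact hz
    simpa [Metric.eventually_nhds_iff] using h
  obtain ⟨η, hη, hsep⟩ : ∃ η > (0 : ℝ), ∀ x ∈ S, ∀ y ∈ S, x ≠ y → 2 * η ≤ ‖x - y‖ := by
    have h : ∀ᶠ η in 𝓝[>] (0 : ℝ), ∀ x ∈ S, ∀ y ∈ S, x ≠ y → 2 * η ≤ ‖x - y‖ := by
      refine (Filter.eventually_all_finset _).2 fun x _ =>
        (Filter.eventually_all_finset _).2 fun y _ => ?_
      by_cases hxy : x = y
      · simp [hxy]
      · have hp : 0 < ‖x - y‖ / 2 := half_pos (norm_pos_iff.2 (sub_ne_zero.2 hxy))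
        filter_upwards [nhdsWithin_le_nhds (eventually_lt_nhds hp)] with η h _
        linarith
    obtain ⟨η, h1, h2⟩ := (h.and self_mem_nhdsWithin).exists
    exact ⟨η, h2, h1⟩
  set D : ℝ := δ + ∑ x ∈ S, ∑ y ∈ S, ‖x - y‖ with hDdef
  have hD0 : 0 < D := by positivity
  obtain ⟨r, hr, hmatch⟩ := exists_matching hG0m (lt_min hδ hη) fun x hx y hy hxy =>
    (mul_le_mul_of_nonneg_left (min_le_right δ η) zero_le_two).trans (hsep x hx y hy hxy)
  refine ⟨r, hr, c / (2 * (N + 1) * (s * (1 + D))), by positivity, fun G hG hW => ?_⟩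
  obtain ⟨T, hTinj, hTG, hTδ⟩ := hmatch G hG hW
  rcases eq_or_ne (phiDist Φ G G0) ⊤ with htop | htop
  · rw [htop]; exact le_top
  refine ENNReal.ofReal_le_of_le_toReal ?_
  set P := (phiDist Φ G G0).toReal with hP
  have hP0 : 0 ≤ P := ENNReal.toReal_nonneg
  have hΦP : ∀ φ ∈ Φ, |mixInt G φ - mixInt G0 φ| ≤ P := fun φ hφ =>
    (ENNReal.ofReal_le_iff_le_toReal htop).1
      (le_iSup₂ (f := fun φ (_ : φ ∈ Φ) => ENNReal.ofReal |mixInt G φ - mixInt G0 φ|) φ hφ)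
  have hsum : ∀ f : Euc q → ℝ, ∑ y ∈ G.support, f y = ∑ x ∈ S, f (T x) := fun f => by
    rw [hTG, Finset.sum_image hTinj]
  have hGn := nonneg_of_isMixingMeasure hG.1
  set v : (S → ℝ) × (S → Euc q) :=
    (fun x => G (T x) - G0 x, fun x => G (T x) • (T x - x)) with hv
  have hv1 : ∀ x ∈ S, |G (T x) - G0 x| ≤ ‖v‖ := fun x hx =>
    (norm_le_pi_norm v.1 ⟨x, hx⟩).trans (norm_fst_le v)
  have hv2 : ∀ x ∈ S, G (T x) * ‖T x - x‖ ≤ ‖v‖ := fun x hx => by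
    have := (norm_le_pi_norm v.2 ⟨x, hx⟩).trans (norm_snd_le v)
    simpa [hv, norm_smul, abs_of_nonneg (hGn _)] using this
  have hWv : Wpow 1 G G0 ≤ s * (1 + D) * ‖v‖ := by
    refine (Wpow_one_le_of_matching hG.1 hG0m hTinj hTG (D := D) fun x hx y hy => ?_).trans ?_
    · have h1 : ‖x - y‖ ≤ ∑ x ∈ S, ∑ y ∈ S, ‖x - y‖ :=
        (Finset.single_le_sum (f := fun y => ‖x - y‖) (fun _ _ => norm_nonneg _) hy).trans
          (Finset.single_le_sum (f := fun x => ∑ y ∈ S, ‖x - y‖)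
            (fun _ _ => Finset.sum_nonneg fun _ _ => norm_nonneg _) hx)
      have h2 := norm_sub_le_norm_sub_add_norm_sub (T x) x y
      linarith [(hTδ x hx).trans_le (min_le_left δ η)]
    · have h1 := Finset.sum_le_card_nsmul S _ _ hv2
      have h2 := Finset.sum_le_card_nsmul S _ _ hv1
      rw [nsmul_eq_mul] at h1 h2
      have h3 := mul_le_mul_of_nonneg_left h2 hD0.le
      linarith
  have hi : ∀ i ∈ F, |(i.elim (totalMass S) fun φ => firstOrder S φ :
      ((S → ℝ) × (S → Euc q)) →L[ℝ] ℝ) v| ≤ P + s * (ε * ‖v‖) := by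
    intro i hiF
    cases i with
    | none =>
      have h0 : totalMass S v = 0 := by
        rw [totalMass_apply, Finset.sum_coe_sort S fun x => G (T x) - G0 x,
          Finset.sum_sub_distrib, ← hsum, hG.1.2.1, hS, hG0m.2.1, sub_self]
      simp only [Option.elim_none, h0, abs_zero]
      positivity
    | some φ =>
      have hdiff : firstOrder S φ v = (mixInt G φ - mixInt G0 φ) -
          ∑ x ∈ S, G (T x) * (φ.1 (x + (T x - x)) - φ.1 x - fderiv ℝ φ.1 x (T x - x)) := by
        rw [firstOrder_apply, mixInt, mixInt, hsum, ← hS, ← Finset.sum_sub_distrib,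
          ← Finset.sum_sub_distrib, ← Finset.sum_coe_sort S]
        refine Finset.sum_congr rfl fun x _ => ?_
        simp only [hv, map_smul, smul_eq_mul, add_sub_cancel]
        ring
      have hrem : |∑ x ∈ S, G (T x) *
          (φ.1 (x + (T x - x)) - φ.1 x - fderiv ℝ φ.1 x (T x - x))| ≤ s * (ε * ‖v‖) := by
        refine (Finset.abs_sum_le_sum_abs _ _).trans ?_
        rw [hs, ← nsmul_eq_mul]
        refine Finset.sum_le_card_nsmul S _ _ fun x hx => ?_
        rw [abs_mul, abs_of_nonneg (hGn _)]
        calc _ ≤ G (T x) * (ε * ‖T x - x‖) := mul_le_mul_of_nonneg_left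
              (hloc _ ((hTδ x hx).trans_le (min_le_left δ η)) x hx _ hiF φ rfl) (hGn _)
          _ = ε * (G (T x) * ‖T x - x‖) := by ring
          _ ≤ ε * ‖v‖ := mul_le_mul_of_nonneg_left (hv2 x hx) hε.le
      simp only [Option.elim_some, hdiff]
      exact (abs_sub _ _).trans (add_le_add (hΦP φ.1 φ.2) hrem)
  have hcv : c * ‖v‖ ≤ (N + 1) * (P + s * (ε * ‖v‖)) := by
    have h := (hF v).trans (Finset.sum_le_card_nsmul F _ _ hi)
    rw [nsmul_eq_mul] at h
    have : 0 ≤ P + s * (ε * ‖v‖) := by positivity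
    linarith
  have hεv : (N + 1) * (s * (ε * ‖v‖)) = c * ‖v‖ / 2 := by
    rw [hεdef]; field_simp
  rw [div_mul_eq_mul_div, div_le_iff₀ (by positivity)]
  have h1 : c * Wpow 1 G G0 ≤ c * (s * (1 + D) * ‖v‖) := mul_le_mul_of_nonneg_left hWv hc.le
  have h2 : c * ‖v‖ ≤ 2 * (N + 1) * P := by linarith
  have h3 := mul_le_mul_of_nonneg_left h2 (by positivity : 0 ≤ s * (1 + D))
  linarith

end
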